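/- For strong digraphs G and H, each of order at least 2, the strong subgraph 2-arc-connectivity of the Cartesian product satisfies λ_2(G □ H) ≤ min{λ(G)·|V(H)|, λ(H)·|V(G)|, δ⁺(G)+δ⁺(H), δ⁻(G)+δ⁻(H)}. -/

import Mathlib

/-- The set of arcs of a digraph. -/
def Digraph.ArcSet {V : Type*} (D : Digraph V) : Set (V × V) := {p | D.Adj p.1 p.2}

/-- Delete a set of arcs from a digraph. -/
def Digraph.DeleteArcs {V : Type*} (D : Digraph V) (F : Set (V × V)) : Digraph V :=
  ⟨fun u v => D.Adj u v ∧ (u, v) ∉ F⟩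

/-- A digraph is strong if every vertex can reach every other vertex by a directed walk. -/
def Digraph.IsStrong {V : Type*} (D : Digraph V) : Prop :=
  ∀ u v : V, Relation.ReflTransGen D.Adj u v

/-- The arc-strong connectivity: the minimum number of arcs whose removal
destroys strong connectivity. -/
noncomputable def Digraph.arcConn {V : Type*} (D : Digraph V) : ℕ :=
  sInf {k | ∃ F : Set (V × V), F ⊆ D.ArcSet ∧ F.ncard = k ∧ ¬ (D.DeleteArcs F).IsStrong}

noncomputable def Digraph.outDeg {V : Type*} (D : Digraph V) (v : V) : ℕ :=
  {w | D.Adj v w}.ncard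

noncomputable def Digraph.inDeg {V : Type*} (D : Digraph V) (v : V) : ℕ :=
  {w | D.Adj w v}.ncard

/-- Minimum out-degree. -/
noncomputable def Digraph.minOutDeg {V : Type*} (D : Digraph V) : ℕ := ⨅ v, D.outDeg v

/-- Minimum in-degree. -/
noncomputable def Digraph.minInDeg {V : Type*} (D : Digraph V) : ℕ := ⨅ v, D.inDeg v

/-- Cartesian product of digraphs. -/
def Digraph.cartProd {V W : Type*} (G : Digraph V) (H : Digraph W) : Digraph (V × W) :=
  ⟨fun a b => (G.Adj a.1 b.1 ∧ a.2 = b.2) ∨ (a.1 = b.1 ∧ H.Adj a.2 b.2)⟩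

/-- `B` is the arc set of an `S`-strong subgraph of `D`: the arcs of `B` are arcs of `D`,
and the subgraph with vertex set `S` together with all endpoints of `B`, and arc set `B`,
is strongly connected. -/
def Digraph.IsStrongSubgraphOn {V : Type*} (D : Digraph V) (S : Set V) (B : Set (V × V)) :
    Prop :=
  B ⊆ D.ArcSet ∧
  ∀ u ∈ S ∪ {v | ∃ e ∈ B, v = e.1 ∨ v = e.2},
    ∀ w ∈ S ∪ {v | ∃ e ∈ B, v = e.1 ∨ v = e.2},
      Relation.ReflTransGen (fun a b => (a, b) ∈ B) u w

/-- `λ_S(D)`: the maximum number of pairwise arc-disjoint `S`-strong subgraphs of `D`. -/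
noncomputable def Digraph.lambdaS {V : Type*} (D : Digraph V) (S : Set V) : ℕ :=
  sSup {k | ∃ f : Fin k → Set (V × V),
    (∀ i, D.IsStrongSubgraphOn S (f i)) ∧
    ∀ i j, i ≠ j → Disjoint (f i) (f j)}

/-- `λ_k(D)`: the strong subgraph `k`-arc-connectivity. -/
noncomputable def Digraph.lambdaK {V : Type*} (D : Digraph V) (k : ℕ) : ℕ :=
  sInf {m | ∃ S : Set V, S.ncard = k ∧ D.lambdaS S = m}

/-- The complete biorientation of an undirected graph. -/
def SimpleGraph.biorient {V : Type*} (G : SimpleGraph V) : Digraph V := ⟨G.Adj⟩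

/-- Edge-connectivity of an undirected graph: the minimum number of edges whose
removal disconnects the graph. -/
noncomputable def SimpleGraph.edgeConn {V : Type*} (G : SimpleGraph V) : ℕ :=
  sInf {k | ∃ F : Set (Sym2 V), F ⊆ G.edgeSet ∧ F.ncard = k ∧ ¬ (G.deleteEdges F).Connected}

/-- The directed cycle on `n` vertices. -/
def dirCycle (n : ℕ) : Digraph (Fin n) :=
  ⟨fun i j => (j : ℕ) = ((i : ℕ) + 1) % n⟩

/-- The complete biorientation of the cycle on `n` vertices. -/
def biCycle (n : ℕ) : Digraph (Fin n) :=
  ⟨fun i j => (j : ℕ) = ((i : ℕ) + 1) % n ∨ (i : ℕ) = ((j : ℕ) + 1) % n⟩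

/-- The complete digraph on `n` vertices. -/
def completeDigraph (n : ℕ) : Digraph (Fin n) := ⟨fun i j => i ≠ j⟩

theorem Relation.ReflTransGen.exists_crossing {α : Type*} {r : α → α → Prop} {U : Set α} {u w : α}
    (h : Relation.ReflTransGen r u w) (hu : u ∈ U) (hw : w ∉ U) :
    ∃ a b, r a b ∧ a ∈ U ∧ b ∉ U := by
  induction h with
  | refl => exact absurd hu hw
  | @tail b c _ hbc ih =>
    by_cases hb : b ∈ U
    · exact ⟨b, c, hbc, hb, hw⟩
    · exact ih hb

/-- If all arcs leaving `U` lie in `C`, then `C` bounds `λ_2` as soon as `U` is a nontrivial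
vertex set. -/
theorem Digraph.lambdaK_two_le_ncard {V : Type*} [Finite V] (D : Digraph V) (U : Set V)
    (C : Set (V × V)) (hC : ∀ a b, D.Adj a b → a ∈ U → b ∉ U → (a, b) ∈ C)
    {x y : V} (hx : x ∈ U) (hy : y ∉ U) : D.lambdaK 2 ≤ C.ncard := by
  have hxy : x ≠ y := fun h => hy (h ▸ hx)
  have h1 : D.lambdaK 2 ≤ D.lambdaS {x, y} :=
    Nat.sInf_le ⟨{x, y}, Set.ncard_pair hxy, rfl⟩
  refine h1.trans (csSup_le ⟨0, fun i => i.elim0, fun i => i.elim0, fun i => i.elim0⟩ ?_)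
  rintro k ⟨f, hf, hdisj⟩
  have key : ∀ i, ∃ e, e ∈ f i ∧ e ∈ C := by
    intro i
    obtain ⟨a, b, hab, ha, hb⟩ :=
      ((hf i).2 x (by simp) y (by simp)).exists_crossing hx hy
    exact ⟨(a, b), hab, hC a b ((hf i).1 hab) ha hb⟩
  choose e he heC using key
  have hinj : Function.Injective e := by
    intro i j hij
    by_contra hne
    exact Set.disjoint_left.1 (hdisj i j hne) (he i) (hij ▸ he j)
  calc k = (Set.range e).ncard := by
        rw [← Set.image_univ, Set.ncard_image_of_injective _ hinj, Set.ncard_univ, Nat.card_fin]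
    _ ≤ C.ncard := Set.ncard_le_ncard (Set.range_subset_iff.2 heC) C.toFinite

/-- Some minimum arc cut contains all arcs leaving a nontrivial vertex set. -/
theorem Digraph.exists_cut_ncard_eq_arcConn {V : Type*} [Nontrivial V] (D : Digraph V) :
    ∃ (U : Set V) (F : Set (V × V)) (x y : V), F.ncard = D.arcConn ∧ x ∈ U ∧ y ∉ U ∧
      ∀ a b, D.Adj a b → a ∈ U → b ∉ U → (a, b) ∈ F := by
  have hne : {k | ∃ F : Set (V × V), F ⊆ D.ArcSet ∧ F.ncard = k ∧
      ¬ (D.DeleteArcs F).IsStrong}.Nonempty := by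
    refine ⟨_, D.ArcSet, subset_rfl, rfl, fun h => ?_⟩
    obtain ⟨x, y, hxy⟩ := exists_pair_ne V
    obtain ⟨a, b, hab, -⟩ :=
      (h x y).exists_crossing (U := {x}) rfl (fun h => hxy h.symm)
    exact hab.2 hab.1
  obtain ⟨F, -, hcard, hF⟩ := Nat.sInf_mem hne
  simp only [Digraph.IsStrong, not_forall] at hF
  obtain ⟨x, y, hxy⟩ := hF
  refine ⟨{v | Relation.ReflTransGen (D.DeleteArcs F).Adj x v}, F, x, y, hcard, .refl, hxy,
    fun a b hab ha hb => ?_⟩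
  by_contra hnot
  exact hb (Relation.ReflTransGen.tail ha ⟨hab, hnot⟩)

theorem Digraph.lambdaK_two_cartProd_le_outDeg {V W : Type*} [Finite V] [Finite W] [Nontrivial V]
    (G : Digraph V) (H : Digraph W) (v : V) (w : W) :
    (G.cartProd H).lambdaK 2 ≤ G.outDeg v + H.outDeg w := by
  obtain ⟨v', hv'⟩ := exists_ne v
  refine ((G.cartProd H).lambdaK_two_le_ncard {(v, w)}
    ((fun a => ((v, w), (a, w))) '' {a | G.Adj v a} ∪ (fun b => ((v, w), (v, b))) '' {b | H.Adj w b})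
    ?_ (x := (v, w)) (y := (v', w)) rfl (by simpa using hv')).trans ?_
  · rintro ⟨a, b⟩ ⟨c, d⟩ (⟨h, rfl⟩ | ⟨rfl, h⟩) hU - <;> cases hU
    · exact .inl ⟨c, h, rfl⟩
    · exact .inr ⟨d, h, rfl⟩
  · exact (Set.ncard_union_le _ _).trans
      (Nat.add_le_add (Set.ncard_image_le (Set.toFinite _)) (Set.ncard_image_le (Set.toFinite _)))

theorem Digraph.lambdaK_two_cartProd_le_inDeg {V W : Type*} [Finite V] [Finite W] [Nontrivial V]
    (G : Digraph V) (H : Digraph W) (v : V) (w : W) :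
    (G.cartProd H).lambdaK 2 ≤ G.inDeg v + H.inDeg w := by
  obtain ⟨v', hv'⟩ := exists_ne v
  refine ((G.cartProd H).lambdaK_two_le_ncard {(v, w)}ᶜ
    ((fun a => ((a, w), (v, w))) '' {a | G.Adj a v} ∪ (fun b => ((v, b), (v, w))) '' {b | H.Adj b w})
    ?_ (x := (v', w)) (y := (v, w)) (by simpa using hv') (by simp)).trans ?_
  · rintro ⟨a, b⟩ ⟨c, d⟩ (⟨h, rfl⟩ | ⟨rfl, h⟩) - hU <;> cases not_not.1 hU
    · exact .inl ⟨a, h, rfl⟩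
    · exact .inr ⟨b, h, rfl⟩
  · exact (Set.ncard_union_le _ _).trans
      (Nat.add_le_add (Set.ncard_image_le (Set.toFinite _)) (Set.ncard_image_le (Set.toFinite _)))

theorem Digraph.lambdaK_two_cartProd_le_arcConn_left {V W : Type*} [Finite V] [Finite W]
    [Nontrivial V] [Nonempty W] (G : Digraph V) (H : Digraph W) :
    (G.cartProd H).lambdaK 2 ≤ G.arcConn * Nat.card W := by
  obtain ⟨U, F, x, y, hF, hx, hy, hcut⟩ := G.exists_cut_ncard_eq_arcConn
  obtain ⟨w⟩ := ‹Nonempty W›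
  refine ((G.cartProd H).lambdaK_two_le_ncard {p | p.1 ∈ U}
    ((fun p : (V × V) × W => ((p.1.1, p.2), (p.1.2, p.2))) '' (F ×ˢ Set.univ))
    ?_ (x := (x, w)) (y := (y, w)) hx hy).trans ?_
  · rintro ⟨a, b⟩ ⟨c, d⟩ (⟨h, rfl⟩ | ⟨rfl, h⟩) ha hc
    · exact ⟨((a, c), b), ⟨hcut a c h ha hc, trivial⟩, rfl⟩
    · exact absurd ha hc
  · refine (Set.ncard_image_le (Set.toFinite _)).trans ?_
    rw [Set.ncard_prod, hF, Set.ncard_univ]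

theorem Digraph.lambdaK_two_cartProd_le_arcConn_right {V W : Type*} [Finite V] [Finite W]
    [Nonempty V] [Nontrivial W] (G : Digraph V) (H : Digraph W) :
    (G.cartProd H).lambdaK 2 ≤ H.arcConn * Nat.card V := by
  obtain ⟨U, F, x, y, hF, hx, hy, hcut⟩ := H.exists_cut_ncard_eq_arcConn
  obtain ⟨v⟩ := ‹Nonempty V›
  refine ((G.cartProd H).lambdaK_two_le_ncard {p | p.2 ∈ U}
    ((fun p : (W × W) × V => ((p.2, p.1.1), (p.2, p.1.2))) '' (F ×ˢ Set.univ))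
    ?_ (x := (v, x)) (y := (v, y)) hx hy).trans ?_
  · rintro ⟨a, b⟩ ⟨c, d⟩ (⟨h, rfl⟩ | ⟨rfl, h⟩) ha hc
    · exact absurd ha hc
    · exact ⟨((b, d), a), ⟨hcut b d h ha hc, trivial⟩, rfl⟩
  · refine (Set.ncard_image_le (Set.toFinite _)).trans ?_
    rw [Set.ncard_prod, hF, Set.ncard_univ]

theorem stmt9 {V W : Type*} [Fintype V] [Fintype W]
    (G : Digraph V) (H : Digraph W)
    (hG : G.IsStrong) (hH : H.IsStrong)
    (hV : 2 ≤ Fintype.card V) (hW : 2 ≤ Fintype.card W) :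
    (G.cartProd H).lambdaK 2 ≤
      min (G.arcConn * Fintype.card W)
        (min (H.arcConn * Fintype.card V)
          (min (G.minOutDeg + H.minOutDeg) (G.minInDeg + H.minInDeg))) := by
  have : Nontrivial V := Fintype.one_lt_card_iff_nontrivial.1 hV
  have : Nontrivial W := Fintype.one_lt_card_iff_nontrivial.1 hW
  refine le_min ?_ (le_min ?_ (le_min ?_ ?_))
  · rw [← Nat.card_eq_fintype_card]
    exact G.lambdaK_two_cartProd_le_arcConn_left H
  · rw [← Nat.card_eq_fintype_card]
    exact G.lambdaK_two_cartProd_le_arcConn_right H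
  · obtain ⟨v, hv⟩ := exists_eq_ciInf_of_finite (f := G.outDeg)
    obtain ⟨w, hw⟩ := exists_eq_ciInf_of_finite (f := H.outDeg)
    rw [Digraph.minOutDeg, Digraph.minOutDeg, ← hv, ← hw]
    exact G.lambdaK_two_cartProd_le_outDeg H v w
  · obtain ⟨v, hv⟩ := exists_eq_ciInf_of_finite (f := G.inDeg)
    obtain ⟨w, hw⟩ := exists_eq_ciInf_of_finite (f := H.inDeg)
    rw [Digraph.minInDeg, Digraph.minInDeg, ← hv, ← hw]
    exact G.lambdaK_two_cartProd_le_inDeg H v w
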